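/- For every ε > 0 there exists N such that every finite connected simple graph G with n ≥ N vertices has cover time E_G(C) at least (1 − ε)·n·log n and at most (1 + ε)·(4/27)·n³. -/

import Mathlib

open scoped BigOperators

namespace CoverTimePaper

variable {V : Type} [Fintype V]

/-- Degree of a vertex (no decidability assumptions). -/
noncomputable def deg (G : SimpleGraph V) (v : V) : ℕ := Nat.card {u // G.Adj v u}

/-- Maximum degree. -/
noncomputable def maxDeg (G : SimpleGraph V) : ℕ := ⨆ v : V, deg G v

/-- Number of edges. -/
noncomputable def numEdges {W : Type} (G : SimpleGraph W) : ℕ := Nat.card G.edgeSet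

open Classical in
/-- One-step transition probability of the simple random walk. -/
noncomputable def transProb (G : SimpleGraph V) (u v : V) : ℝ :=
  if G.Adj u v then ((deg G u : ℝ))⁻¹ else 0

open Classical in
/-- Probability of a given trajectory of length `t` started at `v`. -/
noncomputable def pathProb (G : SimpleGraph V) (v : V) {t : ℕ} (ω : Fin (t + 1) → V) : ℝ :=
  (if ω 0 = v then (1 : ℝ) else 0) *
    ∏ i : Fin t, transProb G (ω i.castSucc) (ω i.succ)

open Classical in
/-- Probability that the walk started at `v` has NOT visited all vertices by time `t`. -/
noncomputable def notCoveredProb (G : SimpleGraph V) (v : V) (t : ℕ) : ℝ :=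
  ∑ ω : Fin (t + 1) → V, if Set.range ω = Set.univ then 0 else pathProb G v ω

/-- Expected cover time from `v`:  `E_v C = ∑_{t ≥ 0} P(C > t)`. -/
noncomputable def coverTimeFrom (G : SimpleGraph V) (v : V) : ℝ :=
  ∑' t : ℕ, notCoveredProb G v t

/-- Cover time of the graph: `E_G(C) = max_v E_v(C)`. -/
noncomputable def coverTime (G : SimpleGraph V) : ℝ := ⨆ v : V, coverTimeFrom G v

open Classical in
/-- Probability that the walk started at `v` has not hit `u` by time `t`. -/
noncomputable def notHitProb (G : SimpleGraph V) (u v : V) (t : ℕ) : ℝ :=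
  ∑ ω : Fin (t + 1) → V, if (∀ i, ω i ≠ u) then pathProb G v ω else 0

/-- Hitting time `H(u,v)`: expected number of steps for the walk started at `v`
to reach `u`, via `E T = ∑_{t ≥ 0} P(T > t)`. -/
noncomputable def hitTime (G : SimpleGraph V) (u v : V) : ℝ :=
  ∑' t : ℕ, notHitProb G u v t

/-- Commute time `C(u,v) = H(u,v) + H(v,u)`. -/
noncomputable def commuteTime (G : SimpleGraph V) (u v : V) : ℝ :=
  hitTime G u v + hitTime G v u

/-- Difference time `D(u,v) = H(u,v) - H(v,u)`. -/
noncomputable def diffTime (G : SimpleGraph V) (u v : V) : ℝ :=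
  hitTime G u v - hitTime G v u

/-- Dirichlet energy `D(f) = ∑_{{x,y} ∈ E} (f x - f y)^2`. -/
noncomputable def energy (G : SimpleGraph V) (f : V → ℝ) : ℝ :=
  ∑' e : G.edgeSet, Sym2.lift ⟨fun x y => (f x - f y) ^ 2, fun x y => by ring⟩ (e : Sym2 V)

/-- Effective resistance
`R(u,v) = sup { (f u - f v)^2 / D(f) : f : V → ℝ, D(f) ≠ 0 }`. -/
noncomputable def effRes (G : SimpleGraph V) (u v : V) : ℝ :=
  sSup {x : ℝ | ∃ f : V → ℝ, energy G f ≠ 0 ∧ x = (f u - f v) ^ 2 / energy G f}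

/- ### Combinatorial (orientable) genus via rotation systems. -/

/-- Reversal of darts, as a permutation. -/
def dartRev {W : Type} (G : SimpleGraph W) : Equiv.Perm G.Dart :=
  Function.Involutive.toPerm SimpleGraph.Dart.symm fun d => SimpleGraph.Dart.symm_symm d

/-- A rotation system (combinatorial embedding into an orientable surface):
a permutation of the darts preserving initial vertices and acting cyclically
(i.e. transitively) on the darts with a common initial vertex. -/
structure RotationSystem {W : Type} (G : SimpleGraph W) where
  toPerm : Equiv.Perm G.Dart
  fst_eq : ∀ d : G.Dart, (toPerm d).toProd.1 = d.toProd.1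
  cyclic : ∀ d d' : G.Dart, d.toProd.1 = d'.toProd.1 → ∃ n : ℕ, (toPerm ^ n) d = d'

/-- Orbit equivalence of a permutation. -/
def permOrbitSetoid {α : Type} (φ : Equiv.Perm α) : Setoid α where
  r a b := ∃ n : ℤ, (φ ^ n) a = b
  iseqv := by
    constructor
    · exact fun a => ⟨0, by simp⟩
    · rintro a b ⟨n, rfl⟩
      exact ⟨-n, by simp [← Equiv.Perm.mul_apply, ← zpow_add]⟩
    · rintro a b c ⟨n, rfl⟩ ⟨m, rfl⟩
      exact ⟨m + n, by simp [← Equiv.Perm.mul_apply, ← zpow_add]⟩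

/-- Number of orbits of a permutation. -/
noncomputable def numOrbits {α : Type} (φ : Equiv.Perm α) : ℕ :=
  Nat.card (Quotient (permOrbitSetoid φ))

/-- Number of faces of a rotation system: orbits of (rotation ∘ dart-reversal). -/
noncomputable def numFaces {W : Type} {G : SimpleGraph W} (rs : RotationSystem G) : ℕ :=
  numOrbits (rs.toPerm * dartRev G)

/-- The minimum (orientable) genus of a finite graph.  For connected graphs,
rotation systems are in bijection with 2-cell embeddings into compact orientable
surfaces, and the resulting surface genus `g` is given by Euler's formula
`|V| - |E| + |F| = 2 - 2g`; the minimum genus of a connected graph is attained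
by such a 2-cell embedding. -/
noncomputable def minGenus {W : Type} (G : SimpleGraph W) : ℕ :=
  sInf {g : ℕ | ∃ rs : RotationSystem G,
    (Nat.card W : ℤ) - (numEdges G : ℤ) + (numFaces rs : ℤ) = 2 - 2 * (g : ℤ)}

end CoverTimePaper


namespace CoverAux

set_option linter.unusedSectionVars false

open CoverTimePaper Finset
open scoped Classical

variable {V : Type} [Fintype V]

/-- Adjacency indicator. -/
noncomputable def adj (G : SimpleGraph V) (x y : V) : ℝ := if G.Adj x y then 1 else 0

/-- Real-valued degree. -/
noncomputable def dg (G : SimpleGraph V) (x : V) : ℝ := ∑ y, adj G x y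

/-- Twice the number of edges. -/
noncomputable def vol (G : SimpleGraph V) : ℝ := ∑ x, dg G x

/-- Laplacian. -/
noncomputable def lap (G : SimpleGraph V) (f : V → ℝ) (x : V) : ℝ := ∑ y, adj G x y * (f x - f y)

lemma adj_comm (G : SimpleGraph V) (x y : V) : adj G x y = adj G y x := by
  simp [adj, G.adj_comm]

lemma adj_nonneg (G : SimpleGraph V) (x y : V) : 0 ≤ adj G x y := by
  unfold adj; split_ifs <;> norm_num

lemma adj_le_one (G : SimpleGraph V) (x y : V) : adj G x y ≤ 1 := by
  unfold adj; split_ifs <;> norm_num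

lemma adj_self (G : SimpleGraph V) (x : V) : adj G x x = 0 := by simp [adj]

lemma dg_eq (G : SimpleGraph V) (x : V) : dg G x = (deg G x : ℝ) := by
  unfold dg adj deg
  rw [Finset.sum_boole, Nat.card_eq_fintype_card, Fintype.card_subtype]

lemma one_le_dg {G : SimpleGraph V} (hG : G.Connected) (hn : 2 ≤ Fintype.card V) (x : V) :
    1 ≤ dg G x := by
  have : Nontrivial V := Fintype.one_lt_card_iff_nontrivial.mp hn
  obtain ⟨y, hy⟩ := hG.preconnected.exists_adj_of_nontrivial x
  calc (1:ℝ) = adj G x y := by simp [adj, hy]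
    _ ≤ dg G x := Finset.single_le_sum (f := fun y => adj G x y)
        (fun i _ => adj_nonneg G x i) (Finset.mem_univ y)

lemma dg_le_vol (G : SimpleGraph V) (x : V) : dg G x ≤ vol G :=
  Finset.single_le_sum (f := fun y => dg G y)
        (fun i _ => Finset.sum_nonneg fun y _ => adj_nonneg G i y) (Finset.mem_univ x)

lemma transProb_eq (G : SimpleGraph V) (x y : V) : transProb G x y = adj G x y / dg G x := by
  rw [dg_eq]; unfold transProb adj; split_ifs <;> simp

lemma transProb_nonneg (G : SimpleGraph V) (x y : V) : 0 ≤ transProb G x y := by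
  unfold transProb; split_ifs <;> positivity

lemma sum_transProb {G : SimpleGraph V} (hG : G.Connected) (hn : 2 ≤ Fintype.card V) (x : V) :
    ∑ y, transProb G x y = 1 := by
  have := one_le_dg hG hn x
  simp_rw [transProb_eq, ← Finset.sum_div]
  exact div_self (by show dg G x ≠ 0; linarith)

lemma lap_eq (G : SimpleGraph V) (f : V → ℝ) (x : V) :
    lap G f x = dg G x * f x - ∑ y, adj G x y * f y := by
  unfold lap dg
  rw [Finset.sum_mul, ← Finset.sum_sub_distrib]
  exact Finset.sum_congr rfl fun y _ => by ring

lemma lap_eq' {G : SimpleGraph V} (hG : G.Connected) (hn : 2 ≤ Fintype.card V)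
    (f : V → ℝ) (x : V) :
    lap G f x = dg G x * (f x - ∑ y, transProb G x y * f y) := by
  have := one_le_dg hG hn x
  rw [lap_eq, mul_sub, Finset.mul_sum]
  congr 1
  refine Finset.sum_congr rfl fun y _ => ?_
  rw [transProb_eq]; field_simp

/-- Maximum principle. -/
lemma max_principle {G : SimpleGraph V} (hG : G.Connected)
    (B : Set V) (hB : B.Nonempty) (f : V → ℝ) (c : ℝ)
    (hsub : ∀ x, x ∉ B → lap G f x ≤ 0) (hbd : ∀ x ∈ B, f x ≤ c) (x : V) : f x ≤ c := by
  have : Nonempty V := ⟨x⟩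
  obtain ⟨x0, hx0⟩ := Finite.exists_max f
  by_contra hc
  push Not at hc
  have hM : c < f x0 := lt_of_lt_of_le hc (hx0 x)
  have step : ∀ y z, G.Adj y z → f y = f x0 → f z = f x0 := by
    intro y z hyz hy
    have hyB : y ∉ B := fun h => by have := hbd y h; linarith
    have h1 := hsub y hyB
    have h2 : adj G y z * (f y - f z) ≤ lap G f y :=
      Finset.single_le_sum (f := fun z => adj G y z * (f y - f z))
        (fun i _ => mul_nonneg (adj_nonneg G y i) (by rw [hy]; linarith [hx0 i])) (Finset.mem_univ z)
    have h3 : adj G y z = 1 := by simp [adj, hyz]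
    rw [h3] at h2
    have := hx0 z
    linarith
  have walk : ∀ y z, G.Walk y z → f y = f x0 → f z = f x0 := by
    intro y z p
    induction p with
    | nil => exact id
    | cons h p ih => exact fun hy => ih (step _ _ h hy)
  obtain ⟨b, hb⟩ := hB
  obtain ⟨p⟩ := hG.preconnected x0 b
  have := walk _ _ p rfl
  have := hbd b hb
  linarith

lemma lap_neg (G : SimpleGraph V) (f : V → ℝ) (x : V) :
    lap G (fun y => - f y) x = - lap G f x := by
  unfold lap; rw [← Finset.sum_neg_distrib]; exact Finset.sum_congr rfl fun y _ => by ring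

lemma lap_sub (G : SimpleGraph V) (f g : V → ℝ) (x : V) :
    lap G (fun y => f y - g y) x = lap G f x - lap G g x := by
  unfold lap; rw [← Finset.sum_sub_distrib]; exact Finset.sum_congr rfl fun y _ => by ring

lemma min_principle {G : SimpleGraph V} (hG : G.Connected)
    (B : Set V) (hB : B.Nonempty) (f : V → ℝ) (c : ℝ)
    (hsub : ∀ x, x ∉ B → 0 ≤ lap G f x) (hbd : ∀ x ∈ B, c ≤ f x) (x : V) : c ≤ f x := by
  have := max_principle hG B hB (fun y => - f y) (-c)
    (fun x hx => by rw [lap_neg]; linarith [hsub x hx]) (fun x hx => by linarith [hbd x hx]) x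
  linarith

/-- Existence of hitting-time functions. -/
lemma exists_hit {G : SimpleGraph V} (hG : G.Connected) (v : V) :
    ∃ f : V → ℝ, f v = 0 ∧ (∀ x, x ≠ v → lap G f x = dg G x) ∧ ∀ x, 0 ≤ f x := by
  let T : (V → ℝ) →ₗ[ℝ] (V → ℝ) :=
    { toFun := fun f x => if x = v then f v else lap G f x
      map_add' := by
        intro f g; ext x
        by_cases h : x = v
        · simp [h]
        · simp only [h, if_false, Pi.add_apply, lap]
          rw [← Finset.sum_add_distrib]; exact Finset.sum_congr rfl fun y _ => by ring
      map_smul' := by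
        intro c f; ext x
        by_cases h : x = v
        · simp [h]
        · simp only [h, if_false, Pi.smul_apply, lap, smul_eq_mul, RingHom.id_apply]
          rw [Finset.mul_sum]; exact Finset.sum_congr rfl fun y _ => by ring }
  have hT : ∀ f x, T f x = if x = v then f v else lap G f x := fun f x => rfl
  have hinj : Function.Injective T := by
    rw [injective_iff_map_eq_zero]
    intro f hf
    have hv : f v = 0 := by have := congrFun hf v; simpa [hT] using this
    have hl : ∀ x, x ∉ ({v} : Set V) → lap G f x = 0 := by
      intro x hx
      have hx' : x ≠ v := hx
      have := congrFun hf x; simpa [hT, hx'] using this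
    ext x
    apply le_antisymm
    · exact max_principle hG {v} ⟨v, rfl⟩ f 0 (fun x hx => (hl x hx).le)
        (fun x hx => by rw [Set.mem_singleton_iff.mp hx, hv]) x
    · exact min_principle hG {v} ⟨v, rfl⟩ f 0 (fun x hx => (hl x hx).ge)
        (fun x hx => by rw [Set.mem_singleton_iff.mp hx, hv]) x
  obtain ⟨f, hf⟩ := (LinearMap.injective_iff_surjective.mp hinj) (fun x => if x = v then 0 else dg G x)
  have hv : f v = 0 := by have := congrFun hf v; simpa [hT] using this
  have hl : ∀ x, x ≠ v → lap G f x = dg G x := by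
    intro x hx
    have := congrFun hf x; simpa [hT, hx] using this
  refine ⟨f, hv, hl, fun x => ?_⟩
  refine min_principle hG {v} ⟨v, rfl⟩ f 0 (fun x hx => ?_)
        (fun x hx => by rw [Set.mem_singleton_iff.mp hx, hv]) x
  rw [hl x hx]
  exact Finset.sum_nonneg fun y _ => adj_nonneg G x y

/-- Probability that the set `U` is not covered by time `t` by the walk from `x`. -/
noncomputable def nc (G : SimpleGraph V) : ℕ → V → Finset V → ℝ
  | 0, x, U => if U ⊆ {x} then 0 else 1
  | t + 1, x, U => ∑ y, transProb G x y * nc G t y (U.erase x)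

lemma nc_nonneg (G : SimpleGraph V) (t : ℕ) : ∀ x U, 0 ≤ nc G t x U := by
  induction t with
  | zero => intro x U; unfold nc; split_ifs <;> norm_num
  | succ t ih =>
    intro x U; unfold nc
    exact Finset.sum_nonneg fun y _ => mul_nonneg (transProb_nonneg G x y) (ih _ _)

lemma nc_empty (G : SimpleGraph V) (t : ℕ) : ∀ x, nc G t x ∅ = 0 := by
  induction t with
  | zero => intro x; simp [nc]
  | succ t ih => intro x; simp [nc, ih]

lemma nc_mono (G : SimpleGraph V) (t : ℕ) : ∀ x U U', U ⊆ U' → nc G t x U ≤ nc G t x U' := by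
  induction t with
  | zero =>
    intro x U U' h
    simp only [nc]
    split_ifs with h1 h2
    · exact le_rfl
    · norm_num
    · exact absurd (h.trans ‹_›) h1
    · exact le_rfl
  | succ t ih =>
    intro x U U' h; simp only [nc]
    exact Finset.sum_le_sum fun y _ => mul_le_mul_of_nonneg_left
      (ih _ _ _ (Finset.erase_subset_erase x h)) (transProb_nonneg G x y)

lemma pathProb_cons (G : SimpleGraph V) (v a : V) {t : ℕ} (ω : Fin (t + 1) → V) :
    pathProb G v (Fin.cons a ω : Fin (t + 1 + 1) → V) =
      if a = v then ∑ y, transProb G v y * pathProb G y ω else 0 := by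
  unfold pathProb
  rw [Fin.prod_univ_succ]
  by_cases h : a = v
  · subst h
    simp only [Fin.cons_zero, Fin.castSucc_zero, if_true, Fin.cons_succ, one_mul,
      ← Fin.succ_castSucc]
    rw [Finset.sum_eq_single (ω 0)]
    · simp
    · intro b _ hb; simp [hb.symm]
    · simp
  · simp [h]

lemma sum_path_eq_nc (G : SimpleGraph V) (t : ℕ) : ∀ (v : V) (U : Finset V),
    (∑ ω : Fin (t + 1) → V, if (U : Set V) ⊆ Set.range ω then 0 else pathProb G v ω) =
      nc G t v U := by
  induction t with
  | zero =>
    intro v U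
    rw [Finset.sum_eq_single (fun _ => v)]
    · have : Set.range (fun _ : Fin (0 + 1) => v) = {v} := by simp
      simp only [this, nc, pathProb]
      have h2 : ((U : Set V) ⊆ {v}) ↔ U ⊆ {v} := by
        rw [← Finset.coe_singleton, Finset.coe_subset]
      simp [h2]
    · intro ω _ hω
      have : ω 0 ≠ v := by
        intro h; apply hω; ext i; rw [← h]; congr 1; exact Fin.eq_zero i
      simp [pathProb, this]
    · simp
  | succ t ih =>
    intro v U
    have hcons : ∀ (a : V) (ω : Fin (t + 1) → V),
        (Fin.consEquiv (fun _ : Fin (t + 1 + 1) => V)) (a, ω) = Fin.cons a ω := fun _ _ => rfl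
    rw [← (Fin.consEquiv (fun _ : Fin (t + 1 + 1) => V)).sum_comp, Fintype.sum_prod_type]
    simp_rw [hcons]
    rw [Finset.sum_eq_single v]
    · simp only [nc, ← ih, Finset.mul_sum]
      rw [Finset.sum_comm]
      refine Finset.sum_congr rfl fun ω _ => ?_
      have hs : ((U : Set V) ⊆ Set.range (Fin.cons v ω : Fin (t + 1 + 1) → V)) ↔
          ((U.erase v : Finset V) : Set V) ⊆ Set.range ω := by
        rw [Fin.range_cons, Finset.coe_erase, Set.sdiff_subset_iff, Set.singleton_union]
      simp only [hs, pathProb_cons]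
      split_ifs <;> simp
    · intro a _ ha
      refine Finset.sum_eq_zero fun ω _ => ?_
      simp only [pathProb_cons]
      simp [ha]
    · simp

lemma notCovered_eq (G : SimpleGraph V) (v : V) (t : ℕ) :
    notCoveredProb G v t = nc G t v Finset.univ := by
  rw [← sum_path_eq_nc]
  unfold notCoveredProb
  refine Finset.sum_congr rfl fun ω _ => ?_
  simp [Set.univ_subset_iff]

/-- Expected time to cover `U` starting from `x`. -/
noncomputable def F (G : SimpleGraph V) (x : V) (U : Finset V) : ℝ := ∑' t, nc G t x U

lemma coverTimeFrom_eq (G : SimpleGraph V) (v : V) :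
    coverTimeFrom G v = F G v Finset.univ := by
  unfold coverTimeFrom F
  simp_rw [notCovered_eq]

lemma summable_nc {G : SimpleGraph V} (hG : G.Connected) (hn : 2 ≤ Fintype.card V)
    (x : V) (U : Finset V) : Summable fun t => nc G t x U := by
  choose f hf0 hf1 hf2 using fun v => exists_hit hG v
  have key : ∀ T : ℕ, ∀ x U, ∑ t ∈ Finset.range T, nc G t x U ≤ ∑ w ∈ U, f w x := by
    intro T
    induction T with
    | zero => intro x U; simpa using Finset.sum_nonneg fun w _ => hf2 w x
    | succ T ih =>
      intro x U
      rw [Finset.sum_range_succ']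
      simp only [nc]
      rw [Finset.sum_comm]
      simp_rw [← Finset.mul_sum]
      have h1 : ∑ y, transProb G x y * ∑ t ∈ Finset.range T, nc G t y (U.erase x) ≤
          ∑ y, transProb G x y * ∑ w ∈ U.erase x, f w y :=
        Finset.sum_le_sum fun y _ => mul_le_mul_of_nonneg_left (ih _ _) (transProb_nonneg G x y)
      have h2 : ∑ w ∈ U, f w x = ∑ w ∈ U.erase x, f w x := by
        by_cases hx : x ∈ U
        · rw [← Finset.add_sum_erase _ _ hx, hf0, zero_add]
        · rw [Finset.erase_eq_of_notMem hx]
      have h3 : ∑ w ∈ U.erase x, f w x =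
          ∑ w ∈ U.erase x, (1 + ∑ y, transProb G x y * f w y) := by
        refine Finset.sum_congr rfl fun w hw => ?_
        have h4 := hf1 w x (Finset.ne_of_mem_erase hw).symm
        rw [lap_eq' hG hn] at h4
        have h5 := one_le_dg hG hn x
        have h6 : f w x - ∑ y, transProb G x y * f w y = 1 := by
          have : dg G x ≠ 0 := by linarith
          exact mul_left_cancel₀ this (by rw [h4, mul_one])
        linarith
      have h4 : ∑ y, transProb G x y * ∑ w ∈ U.erase x, f w y =
          ∑ w ∈ U.erase x, ∑ y, transProb G x y * f w y := by
        rw [Finset.sum_comm]; simp_rw [Finset.mul_sum]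
      have h5 : (if U ⊆ {x} then (0:ℝ) else 1) ≤ (U.erase x).card := by
        split_ifs with h
        · positivity
        · have : (U.erase x).Nonempty := by
            rw [Finset.nonempty_iff_ne_empty]; intro he; apply h
            rw [Finset.erase_eq_empty_iff] at he
            rcases he with h | h <;> simp [h]
          exact_mod_cast this.card_pos
      rw [h2, h3, Finset.sum_add_distrib, ← h4]
      simp only [Finset.sum_const, nsmul_eq_mul, mul_one]
      linarith
  exact summable_of_sum_range_le (fun t => nc_nonneg G t x U) (fun T => key T x U)

lemma F_nonneg (G : SimpleGraph V) (x : V) (U : Finset V) : 0 ≤ F G x U :=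
  tsum_nonneg fun t => nc_nonneg G t x U

lemma F_empty (G : SimpleGraph V) (x : V) : F G x ∅ = 0 := by
  unfold F; simp [nc_empty]

lemma F_mono {G : SimpleGraph V} (hG : G.Connected) (hn : 2 ≤ Fintype.card V)
    (x : V) {U U' : Finset V} (h : U ⊆ U') : F G x U ≤ F G x U' :=
  (summable_nc hG hn x U).tsum_le_tsum (fun t => nc_mono G t x U U' h) (summable_nc hG hn x U')

lemma F_rec {G : SimpleGraph V} (hG : G.Connected) (hn : 2 ≤ Fintype.card V)
    (x : V) (U : Finset V) :
    F G x U = (if U ⊆ {x} then 0 else 1) + ∑ y, transProb G x y * F G y (U.erase x) := by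
  unfold F
  rw [(summable_nc hG hn x U).tsum_eq_zero_add]
  simp only [nc]
  rw [Summable.tsum_finsetSum fun y _ => (summable_nc hG hn y (U.erase x)).mul_left _]
  simp_rw [tsum_mul_left]

lemma F_mem {G : SimpleGraph V} (hG : G.Connected) (hn : 2 ≤ Fintype.card V)
    (x : V) (U : Finset V) : F G x (U.erase x) = F G x U := by
  rw [F_rec hG hn x U, F_rec hG hn x (U.erase x), Finset.erase_idem]
  congr 1
  have : U.erase x ⊆ {x} ↔ U ⊆ {x} := by
    constructor
    · intro h y hy
      by_contra hxy
      exact hxy (h (Finset.mem_erase.mpr ⟨by simpa using hxy, hy⟩))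
    · exact fun h => (Finset.erase_subset _ _).trans h
  simp [this]

lemma lap_F {G : SimpleGraph V} (hG : G.Connected) (hn : 2 ≤ Fintype.card V)
    (x : V) (U : Finset V) (hU : U.Nonempty) (hx : x ∉ U) :
    lap G (fun y => F G y U) x = dg G x := by
  rw [lap_eq' hG hn]
  have h := F_rec hG hn x U
  have h1 : ¬ U ⊆ {x} := by
    intro h; obtain ⟨y, hy⟩ := hU
    have := Finset.mem_singleton.mp (h hy); subst this; exact hx hy
  rw [Finset.erase_eq_of_notMem hx, if_neg h1] at h
  have : F G x U - ∑ y, transProb G x y * F G y U = 1 := by linarith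
  rw [this, mul_one]

/-- Hitting time of `w` from `x`. -/
noncomputable def H (G : SimpleGraph V) (w x : V) : ℝ := F G x {w}

lemma H_self {G : SimpleGraph V} (hG : G.Connected) (hn : 2 ≤ Fintype.card V) (w : V) :
    H G w w = 0 := by
  unfold H; rw [← F_mem hG hn]; simp [F_empty]

lemma H_nonneg (G : SimpleGraph V) (w x : V) : 0 ≤ H G w x := F_nonneg G x {w}

/-- Green's identity. -/
lemma green (G : SimpleGraph V) (f g : V → ℝ) :
    ∑ x, f x * lap G g x = ∑ x, g x * lap G f x := by
  have h : ∀ f g : V → ℝ, ∑ x, f x * lap G g x =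
      ∑ x, dg G x * f x * g x - ∑ x, ∑ y, adj G x y * (f x * g y) := by
    intro f g
    rw [← Finset.sum_sub_distrib]
    refine Finset.sum_congr rfl fun x _ => ?_
    rw [lap_eq, mul_sub, Finset.mul_sum]
    congr 1
    · ring
    · exact Finset.sum_congr rfl fun y _ => by ring
  rw [h f g, h g f]
  congr 1
  · exact Finset.sum_congr rfl fun y _ => by ring
  · rw [Finset.sum_comm]
    exact Finset.sum_congr rfl fun x _ => Finset.sum_congr rfl fun y _ => by
      rw [adj_comm]; ring

lemma energy_eq (G : SimpleGraph V) (g : V → ℝ) :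
    2 * ∑ x, g x * lap G g x = ∑ x, ∑ y, adj G x y * (g x - g y) ^ 2 := by
  have h1 : ∑ x, g x * lap G g x = ∑ x, ∑ y, adj G x y * (g x * (g x - g y)) := by
    refine Finset.sum_congr rfl fun x _ => ?_
    unfold lap; rw [Finset.mul_sum]; exact Finset.sum_congr rfl fun y _ => by ring
  have h2 : ∑ x, g x * lap G g x = ∑ x, ∑ y, adj G x y * (g y * (g y - g x)) := by
    rw [h1, Finset.sum_comm]
    exact Finset.sum_congr rfl fun x _ => Finset.sum_congr rfl fun y _ => by
      rw [adj_comm]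
  rw [two_mul]
  nth_rewrite 1 [h1]
  rw [h2, ← Finset.sum_add_distrib]
  refine Finset.sum_congr rfl fun x _ => ?_
  rw [← Finset.sum_add_distrib]
  exact Finset.sum_congr rfl fun y _ => by ring

lemma energy_nonneg (G : SimpleGraph V) (g : V → ℝ) : 0 ≤ ∑ x, g x * lap G g x := by
  have := energy_eq G g
  have h2 : 0 ≤ ∑ x, ∑ y, adj G x y * (g x - g y) ^ 2 :=
    Finset.sum_nonneg fun x _ => Finset.sum_nonneg fun y _ =>
      mul_nonneg (adj_nonneg G x y) (sq_nonneg _)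
  linarith

lemma sum_lap (G : SimpleGraph V) (g : V → ℝ) : ∑ x, lap G g x = 0 := by
  have := green G (fun _ => 1) g
  simpa [lap] using this

lemma lap_H {G : SimpleGraph V} (hG : G.Connected) (hn : 2 ≤ Fintype.card V) (w x : V) :
    lap G (H G w) x = dg G x - if x = w then vol G else 0 := by
  have h1 : ∀ x, x ≠ w → lap G (H G w) x = dg G x := fun x hx =>
    lap_F hG hn x {w} ⟨w, by simp⟩ (by simpa using hx)
  by_cases hx : x = w
  · subst hx
    have h2 := sum_lap G (H G x)
    rw [← Finset.add_sum_erase _ _ (Finset.mem_univ x)] at h2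
    rw [Finset.sum_congr rfl fun y hy => h1 y (Finset.ne_of_mem_erase hy)] at h2
    have h3 : vol G = dg G x + ∑ y ∈ Finset.univ.erase x, dg G y :=
      (Finset.add_sum_erase _ _ (Finset.mem_univ x)).symm
    simp only [if_true]
    linarith
  · simp [hx, h1 x hx]

/-- Commute time. -/
noncomputable def Cm (G : SimpleGraph V) (u v : V) : ℝ := H G u v + H G v u

lemma Cm_comm (G : SimpleGraph V) (u v : V) : Cm G u v = Cm G v u := add_comm _ _

lemma diff_H {G : SimpleGraph V} (hG : G.Connected) (hn : 2 ≤ Fintype.card V) (u v : V) :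
    vol G * (H G u v - H G v u) = ∑ x, dg G x * H G u x - ∑ x, dg G x * H G v x := by
  have h := green G (H G u) (H G v)
  simp only [lap_H hG hn, mul_sub, Finset.sum_sub_distrib, mul_ite, mul_zero,
    Finset.sum_ite_eq', Finset.mem_univ, if_true] at h
  have h1 : ∀ w, ∑ x, H G w x * dg G x = ∑ x, dg G x * H G w x := fun w =>
    Finset.sum_congr rfl fun y _ => by ring
  rw [h1, h1] at h
  linarith

lemma lap_g {G : SimpleGraph V} (hG : G.Connected) (hn : 2 ≤ Fintype.card V) (u v x : V) :
    lap G (fun y => H G v y - H G u y) x =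
      (if x = u then vol G else 0) - if x = v then vol G else 0 := by
  rw [lap_sub, lap_H hG hn, lap_H hG hn]; ring

lemma pair_g {G : SimpleGraph V} (hG : G.Connected) (hn : 2 ≤ Fintype.card V) (u v : V)
    (f : V → ℝ) : ∑ x, f x * lap G (fun y => H G v y - H G u y) x = vol G * (f u - f v) := by
  simp only [lap_g hG hn, mul_sub, Finset.sum_sub_distrib, mul_ite, mul_zero,
    Finset.sum_ite_eq', Finset.mem_univ, if_true]
  ring

lemma vol_pos {G : SimpleGraph V} (hG : G.Connected) (hn : 2 ≤ Fintype.card V) : 0 < vol G := by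
  have x := hG.nonempty.some
  linarith [dg_le_vol G x, one_le_dg hG hn x]

lemma Cm_le {G : SimpleGraph V} (hG : G.Connected) (hn : 2 ≤ Fintype.card V) {u v : V}
    (h : G.Adj u v) : Cm G u v ≤ vol G := by
  set g : V → ℝ := fun y => H G v y - H G u y with hg
  have h1 := pair_g hG hn u v g
  have h2 := energy_eq G g
  rw [h1] at h2
  have hgu : g u - g v = Cm G u v := by
    simp only [hg, H_self hG hn, Cm]; ring
  have h3 : (∑ y, adj G u y * (g u - g y) ^ 2) + ∑ y, adj G v y * (g v - g y) ^ 2 ≤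
      ∑ x, ∑ y, adj G x y * (g x - g y) ^ 2 := by
    have := Finset.sum_le_sum_of_subset_of_nonneg (f := fun x => ∑ y, adj G x y * (g x - g y) ^ 2)
      (Finset.subset_univ {u, v}) (fun x _ _ => Finset.sum_nonneg fun y _ =>
        mul_nonneg (adj_nonneg G x y) (sq_nonneg _))
    rwa [Finset.sum_pair h.ne] at this
  have h4 : ∀ a b, G.Adj a b → (g a - g b) ^ 2 ≤ ∑ y, adj G a y * (g a - g y) ^ 2 := by
    intro a b hab
    have := Finset.single_le_sum (f := fun y => adj G a y * (g a - g y) ^ 2)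
      (fun y _ => mul_nonneg (adj_nonneg G a y) (sq_nonneg _)) (Finset.mem_univ b)
    simpa [adj, hab] using this
  have h5 := h4 u v h
  have h6 := h4 v u h.symm
  have h7 : Cm G u v ^ 2 ≤ vol G * Cm G u v := by rw [← hgu]; nlinarith
  have h8 : 0 ≤ Cm G u v := add_nonneg (H_nonneg _ _ _) (H_nonneg _ _ _)
  have h9 := vol_pos hG hn
  by_contra hc
  push Not at hc
  nlinarith

lemma le_Cm {G : SimpleGraph V} (hG : G.Connected) (hn : 2 ≤ Fintype.card V) {u v : V}
    (huv : u ≠ v) : vol G / (dg G u + adj G u v) + vol G / (dg G v + adj G u v) ≤ Cm G u v := by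
  set g : V → ℝ := fun y => H G v y - H G u y with hg
  set a := vol G / (dg G u + adj G u v) with ha
  set b := vol G / (dg G v + adj G u v) with hb
  have hA := adj_nonneg G u v
  have hu := one_le_dg hG hn u
  have hv := one_le_dg hG hn v
  have ha' : a * (dg G u + adj G u v) = vol G := div_mul_cancel₀ _ (by linarith)
  have hb' : b * (dg G v + adj G u v) = vol G := div_mul_cancel₀ _ (by linarith)
  let f : V → ℝ := fun x => if x = u then a else if x = v then -b else 0
  have fu : f u = a := by simp [f]
  have fv : f v = -b := by simp [f, huv.symm]
  have fo : ∀ x, x ≠ u → x ≠ v → f x = 0 := fun x h1 h2 => by simp [f, h1, h2]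
  have hgu : g u - g v = Cm G u v := by
    simp only [hg, H_self hG hn, Cm]; ring
  have sum2 : ∀ k : V → ℝ, ∑ x, k x * f x = k u * a - k v * b := by
    intro k
    rw [← Finset.sum_subset (Finset.subset_univ {u, v}), Finset.sum_pair huv, fu, fv]
    · ring
    · intro x _ hx
      simp only [Finset.mem_insert, Finset.mem_singleton, not_or] at hx
      rw [fo x hx.1 hx.2, mul_zero]
  have h1 := pair_g hG hn u v g
  have h2 := pair_g hG hn u v f
  have h3 := energy_nonneg G (fun x => g x - f x)
  have h4 : ∑ x, (g x - f x) * lap G (fun x => g x - f x) x =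
      ∑ x, g x * lap G g x - 2 * ∑ x, f x * lap G g x + ∑ x, f x * lap G f x := by
    have := green G f g
    simp only [lap_sub, sub_mul, mul_sub, Finset.sum_sub_distrib]
    linarith
  have h5 : ∑ x, f x * lap G f x = dg G u * a ^ 2 + dg G v * b ^ 2 + 2 * a * b * adj G u v := by
    have : ∑ x, f x * lap G f x = ∑ x, lap G f x * f x :=
      Finset.sum_congr rfl fun y _ => by ring
    rw [this, sum2, lap_eq, lap_eq, sum2, sum2, adj_self, adj_self, fu, fv, adj_comm G v u]
    ring
  rw [h4, h1, h2, h5, hgu, fu, fv] at h3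
  have hvol := vol_pos hG hn
  have h6 : 2 * a * b * adj G u v ≤ (a ^ 2 + b ^ 2) * adj G u v :=
    mul_le_mul_of_nonneg_right (by nlinarith [sq_nonneg (a - b)]) hA
  have h7 : a ^ 2 * (dg G u + adj G u v) = vol G * a := by rw [← ha']; ring
  have h8 : b ^ 2 * (dg G v + adj G u v) = vol G * b := by rw [← hb']; ring
  have h9 : vol G * (a + b) ≤ vol G * Cm G u v := by nlinarith
  exact le_of_mul_le_mul_left h9 hvol

/-- Foster's identity. -/
lemma foster {G : SimpleGraph V} (hG : G.Connected) (hn : 2 ≤ Fintype.card V) :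
    ∑ x, ∑ y, adj G x y * Cm G x y = 2 * vol G * (Fintype.card V - 1) := by
  have h1 : ∀ w, ∑ y, adj G w y * H G w y = vol G - dg G w := by
    intro w
    have h := lap_H hG hn w w
    rw [lap_eq, H_self hG hn] at h
    simp at h; linarith
  have h2 : ∑ x, ∑ y, adj G x y * H G x y = vol G * (Fintype.card V - 1) := by
    simp_rw [h1]
    rw [Finset.sum_sub_distrib]
    simp only [Finset.sum_const, Finset.card_univ, nsmul_eq_mul]
    show _ - vol G = _
    ring
  have h3 : ∑ x, ∑ y, adj G x y * H G y x = vol G * (Fintype.card V - 1) := by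
    rw [← h2, Finset.sum_comm]
    exact Finset.sum_congr rfl fun x _ => Finset.sum_congr rfl fun y _ => by rw [adj_comm]
  simp only [Cm, mul_add, Finset.sum_add_distrib]
  linarith

lemma F_le_hit {G : SimpleGraph V} (hG : G.Connected) (hn : 2 ≤ Fintype.card V) (w : V)
    (U : Finset V) : ∀ x, F G x U ≤ H G w x + F G w U := by
  induction U using Finset.strongInduction with
  | H U ih =>
    intro x
    rcases U.eq_empty_or_nonempty with h | hU
    · subst h; rw [F_empty, F_empty]; linarith [H_nonneg G w x]
    have := max_principle hG (insert w (U : Set V)) ⟨w, by simp⟩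
      (fun y => F G y U - H G w y) (F G w U) ?_ ?_ x
    · linarith
    · intro y hy
      simp only [Set.mem_insert_iff, Finset.mem_coe, not_or] at hy
      rw [lap_sub, lap_F hG hn y U hU hy.2, lap_H hG hn, if_neg hy.1]
      simp
    · intro y hy
      by_cases hyw : y = w
      · subst hyw; rw [H_self hG hn]; simp
      · have hyU : y ∈ U := by simpa [hyw] using hy
        have h1 := ih (U.erase y) (Finset.erase_ssubset hyU) y
        rw [F_mem hG hn] at h1
        have h2 := F_mono hG hn w (Finset.erase_subset y U)
        linarith

/-- Cost of a tour. -/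
noncomputable def cost (G : SimpleGraph V) : List V → ℝ
  | [] => 0
  | [_] => 0
  | a :: b :: l => H G b a + cost G (b :: l)

lemma F_le_cost {G : SimpleGraph V} (hG : G.Connected) (hn : 2 ≤ Fintype.card V)
    (l : List V) : ∀ (w : V) (U : Finset V), U ⊆ (w :: l).toFinset → F G w U ≤ cost G (w :: l) := by
  induction l with
  | nil =>
    intro w U hU
    have : U.erase w = ∅ := by
      rw [Finset.erase_eq_empty_iff]
      have h : U ⊆ {w} := by simpa using hU
      exact Finset.subset_singleton_iff.mp h
    rw [← F_mem hG hn, this, F_empty]; simp [cost]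
  | cons b l ih =>
    intro w U hU
    rw [← F_mem hG hn]
    have h1 := F_le_hit hG hn b (U.erase w) w
    have h2 := ih b (U.erase w) (by
      intro y hy
      have := hU (Finset.mem_of_mem_erase hy)
      have hne := Finset.ne_of_mem_erase hy
      simp only [List.toFinset_cons, Finset.mem_insert] at this ⊢
      tauto)
    simp only [cost]
    linarith

lemma insert_tour (G : SimpleGraph V) (a b : V) (l : List V) : ∀ v, a ∈ v :: l →
    ∃ l', (v :: l').toFinset = insert b (v :: l).toFinset ∧
      cost G (v :: l') = cost G (v :: l) + Cm G a b := by
  induction l with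
  | nil =>
    intro v h
    have : a = v := by simpa using h
    subst this
    refine ⟨[b, a], ?_, ?_⟩
    · ext x; simp only [List.mem_toFinset, List.mem_cons, Finset.mem_insert, List.not_mem_nil]; tauto
    · simp [cost, Cm]; ring
  | cons c l ih =>
    intro v h
    by_cases hv : a = v
    · subst hv
      refine ⟨b :: a :: c :: l, ?_, ?_⟩
      · ext x; simp only [List.mem_toFinset, List.mem_cons, Finset.mem_insert]; tauto
      · simp [cost, Cm]; ring
    · have : a ∈ c :: l := by
        rcases List.mem_cons.mp h with h | h
        · exact absurd h hv
        · exact h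
      obtain ⟨l', h1, h2⟩ := ih c this
      refine ⟨c :: l', ?_, ?_⟩
      · rw [List.toFinset_cons, h1, List.toFinset_cons (a := v), Finset.insert_comm]
      · simp only [cost, h2]; ring

/-- Graph of edges with small resistance. -/
noncomputable def light (G : SimpleGraph V) (δ : ℝ) : SimpleGraph V where
  Adj x y := G.Adj x y ∧ Cm G x y < δ * vol G
  symm := ⟨fun x y h => ⟨h.1.symm, by rw [Cm_comm]; exact h.2⟩⟩
  loopless := ⟨fun x h => G.loopless.irrefl x h.1⟩

lemma exists_cross {G : SimpleGraph V} (hG : G.Connected) (A : Finset V) (hA : A.Nonempty)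
    (hA' : A ≠ Finset.univ) : ∃ a ∈ A, ∃ b, b ∉ A ∧ G.Adj a b := by
  by_contra hc
  push Not at hc
  apply hA'
  have walk : ∀ y z, G.Walk y z → y ∈ A → z ∈ A := by
    intro y z p
    induction p with
    | nil => exact id
    | cons h p ih => exact fun hy => ih (by by_contra hb; exact hc _ hy _ hb h)
  obtain ⟨a, ha⟩ := hA
  ext z
  obtain ⟨p⟩ := hG.preconnected a z
  simp [walk _ _ p ha]

lemma exists_tour {G : SimpleGraph V} (hG : G.Connected) (hn : 2 ≤ Fintype.card V) (v : V)
    (δ : ℝ) (hδ : 0 < δ) (j : ℕ) : j + 1 ≤ Fintype.card V → ∃ l : List V,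
      (v :: l).toFinset.card = j + 1 ∧
      cost G (v :: l) ≤ vol G * (δ * j +
        ((((v :: l).toFinset.image (light G δ).connectedComponentMk).card : ℝ) - 1)) := by
  have hvol := vol_pos hG hn
  induction j with
  | zero => intro _; exact ⟨[], by simp, by simp [cost]⟩
  | succ j ih =>
    intro hj
    obtain ⟨l, hl1, hl2⟩ := ih (by omega)
    set A := (v :: l).toFinset with hA
    by_cases hc : ∃ a ∈ A, ∃ b, b ∉ A ∧ (light G δ).Adj a b
    · obtain ⟨a, ha, b, hb, hab⟩ := hc
      obtain ⟨l', h1, h2⟩ := insert_tour G a b l v (by simpa [hA] using ha)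
      rw [← hA] at h1
      refine ⟨l', by rw [h1, Finset.card_insert_of_notMem hb, hl1], ?_⟩
      have h3 : (insert b A).image (light G δ).connectedComponentMk =
          A.image (light G δ).connectedComponentMk := by
        rw [Finset.image_insert, Finset.insert_eq_self, Finset.mem_image]
        exact ⟨a, ha, SimpleGraph.ConnectedComponent.sound hab.reachable⟩
      rw [h1, h3, h2]
      have h4 : Cm G a b < δ * vol G := hab.2
      push_cast
      nlinarith
    · push Not at hc
      have hne : A ≠ Finset.univ := by
        intro h; rw [h, Finset.card_univ] at hl1; omega
      have hnon : A.Nonempty := ⟨v, by simp [hA]⟩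
      obtain ⟨a, ha, b, hb, hab⟩ := exists_cross hG A hnon hne
      obtain ⟨l', h1, h2⟩ := insert_tour G a b l v (by simpa [hA] using ha)
      rw [← hA] at h1
      refine ⟨l', by rw [h1, Finset.card_insert_of_notMem hb, hl1], ?_⟩
      have walk : ∀ y z, (light G δ).Walk y z → y ∈ A → z ∈ A := by
        intro y z p
        induction p with
        | nil => exact id
        | cons h p ih => exact fun hy => ih (by by_contra hb; exact hc _ hy _ hb h)
      have h3 : ((insert b A).image (light G δ).connectedComponentMk).card =
          (A.image (light G δ).connectedComponentMk).card + 1 := by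
        rw [Finset.image_insert, Finset.card_insert_of_notMem]
        rw [Finset.mem_image]
        rintro ⟨c, hcA, hcb⟩
        obtain ⟨p⟩ := SimpleGraph.ConnectedComponent.exact hcb
        exact hb (walk _ _ p hcA)
      rw [h1, h3, h2]
      have h4 := Cm_le hG hn hab
      push_cast
      nlinarith

/-- Bound on the volume. -/
lemma vol_le {G : SimpleGraph V} (hG : G.Connected) (hn : 2 ≤ Fintype.card V)
    (δ : ℝ) (hδ : 0 < δ) (k : ℕ)
    (hk : (Finset.univ.image (light G δ).connectedComponentMk).card = k) :
    vol G ≤ ((Fintype.card V : ℝ) - k) ^ 2 + 2 * (Fintype.card V : ℝ)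
      + 2 * (Fintype.card V : ℝ) / δ ∧ k ≤ Fintype.card V := by
  set n : ℝ := ((Fintype.card V : ℕ) : ℝ) with hnn
  have hvol := vol_pos hG hn
  set cm := (light G δ).connectedComponentMk with hcm
  set I := Finset.univ.image cm with hI
  -- pointwise bound
  have h1 : ∀ x y, adj G x y ≤ (if cm x = cm y then 1 else 0) +
      adj G x y * Cm G x y / (δ * vol G) := by
    intro x y
    have hpos : 0 < δ * vol G := by positivity
    have hC : 0 ≤ Cm G x y := add_nonneg (H_nonneg _ _ _) (H_nonneg _ _ _)
    by_cases hadj : G.Adj x y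
    · have ha : adj G x y = 1 := by simp [adj, hadj]
      rw [ha, one_mul]
      by_cases hl : Cm G x y < δ * vol G
      · have : cm x = cm y := SimpleGraph.ConnectedComponent.sound
          (SimpleGraph.Adj.reachable (G := light G δ) ⟨hadj, hl⟩)
        rw [if_pos this]
        have : 0 ≤ Cm G x y / (δ * vol G) := by positivity
        linarith
      · push Not at hl
        have : 1 ≤ Cm G x y / (δ * vol G) := by rw [le_div_iff₀ hpos]; linarith
        split_ifs <;> linarith
    · have ha : adj G x y = 0 := by simp [adj, hadj]
      rw [ha]; simp; split_ifs <;> norm_num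
  have h2 : vol G ≤ ∑ x, ∑ y, (if cm x = cm y then (1:ℝ) else 0) + 2 * (n - 1) / δ := by
    calc vol G = ∑ x, ∑ y, adj G x y := rfl
      _ ≤ ∑ x, ∑ y, ((if cm x = cm y then 1 else 0) + adj G x y * Cm G x y / (δ * vol G)) :=
        Finset.sum_le_sum fun x _ => Finset.sum_le_sum fun y _ => h1 x y
      _ = _ := by
        simp only [Finset.sum_add_distrib]
        congr 1
        simp_rw [← Finset.sum_div]
        rw [foster hG hn]
        field_simp
        rw [hnn]
  -- sizes
  let c : (light G δ).ConnectedComponent → ℝ := fun i => ((Finset.univ.filter fun y => cm y = i).card : ℝ)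
  have hc1 : ∀ i ∈ I, 1 ≤ c i := by
    intro i hi
    obtain ⟨x, _, hx⟩ := Finset.mem_image.mp hi
    have : 0 < (Finset.univ.filter fun y => cm y = i).card :=
      Finset.card_pos.mpr ⟨x, by simp [hx]⟩
    show (1 : ℝ) ≤ ((Finset.univ.filter fun y => cm y = i).card : ℝ)
    exact_mod_cast this
  have hcs : ∑ i ∈ I, c i = n := by
    have := Finset.card_eq_sum_card_image cm Finset.univ
    rw [Finset.card_univ] at this
    rw [hnn, this]; push_cast; rfl
  have h3 : ∑ x, ∑ y, (if cm x = cm y then (1:ℝ) else 0) = ∑ i ∈ I, c i ^ 2 := by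
    have h4 : ∀ x, ∑ y, (if cm x = cm y then (1:ℝ) else 0) = c (cm x) := by
      intro x
      rw [Finset.sum_boole]
      simp only [c]; congr 2; ext y; simp [eq_comm]
    simp_rw [h4]
    rw [← Finset.sum_fiberwise_of_maps_to (g := cm) (t := I)
      (fun x _ => Finset.mem_image_of_mem cm (Finset.mem_univ x))]
    refine Finset.sum_congr rfl fun i _ => ?_
    rw [Finset.sum_congr rfl (g := fun _ => c i) (fun x hx => by
      rw [(Finset.mem_filter.mp hx).2])]
    rw [Finset.sum_const, nsmul_eq_mul, sq]
  have hkn : k ≤ Fintype.card V := by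
    rw [← hk, ← Finset.card_univ]; exact Finset.card_image_le
  have hIk : (I.card : ℝ) = k := by exact_mod_cast hk
  have h5 : ∑ i ∈ I, (c i - 1) = n - k := by
    rw [Finset.sum_sub_distrib, hcs]; simp [hIk]
  have h6 : ∑ i ∈ I, (c i - 1) ^ 2 ≤ (n - k) ^ 2 := by
    rw [← h5]
    have hnn0 : ∀ i ∈ I, 0 ≤ c i - 1 := fun i hi => by linarith [hc1 i hi]
    rw [sq (∑ i ∈ I, (c i - 1)), Finset.sum_mul]
    refine Finset.sum_le_sum fun i hi => ?_
    rw [sq]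
    exact mul_le_mul_of_nonneg_left (Finset.single_le_sum hnn0 hi) (hnn0 i hi)
  have h7 : ∑ i ∈ I, c i ^ 2 = ∑ i ∈ I, (c i - 1) ^ 2 + 2 * n - k := by
    have : ∑ i ∈ I, c i ^ 2 = ∑ i ∈ I, ((c i - 1) ^ 2 + (2 * c i - 1)) :=
      Finset.sum_congr rfl fun i _ => by ring
    rw [this, Finset.sum_add_distrib, Finset.sum_sub_distrib, ← Finset.mul_sum, hcs]
    simp [hIk]; ring
  have h8 : 2 * (n - 1) / δ ≤ 2 * n / δ := by
    apply div_le_div_of_nonneg_right _ hδ.le; linarith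
  refine ⟨?_, hkn⟩
  rw [h3, h7] at h2
  have : (0:ℝ) ≤ k := by positivity
  linarith

lemma upper {G : SimpleGraph V} (hG : G.Connected) (hn : 2 ≤ Fintype.card V)
    (δ : ℝ) (hδ : 0 < δ) (hδ1 : δ ≤ 1) (v : V) :
    coverTimeFrom G v ≤ 4 / 27 * (Fintype.card V : ℝ) ^ 3 + δ * (Fintype.card V : ℝ) ^ 3 +
      8 * (Fintype.card V : ℝ) ^ 2 / δ := by
  rw [coverTimeFrom_eq]
  obtain ⟨l, hl1, hl2⟩ := exists_tour hG hn v δ hδ (Fintype.card V - 1) (by omega)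
  have hl1' : (v :: l).toFinset = Finset.univ := by
    rw [← Finset.card_eq_iff_eq_univ, hl1]; omega
  rw [hl1'] at hl2
  obtain ⟨hv, hk⟩ := vol_le hG hn δ hδ _ rfl
  set k := (Finset.univ.image (light G δ).connectedComponentMk).card
  have h1 := F_le_cost hG hn l v Finset.univ hl1'.ge
  have hkr : (k : ℝ) ≤ Fintype.card V := by exact_mod_cast hk
  have hj : ((Fintype.card V - 1 : ℕ) : ℝ) ≤ Fintype.card V := by exact_mod_cast Nat.sub_le _ _
  have hn' : (2 : ℝ) ≤ Fintype.card V := by exact_mod_cast hn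
  set n : ℝ := ((Fintype.card V : ℕ) : ℝ)
  have hk0 : (0 : ℝ) ≤ k := by positivity
  have hvol := vol_pos hG hn
  have h2 : F G v Finset.univ ≤ vol G * (δ * n + k) := by
    refine (h1.trans hl2).trans (mul_le_mul_of_nonneg_left ?_ hvol.le)
    nlinarith
  have h3 : vol G * (δ * n + k) ≤ ((n - k) ^ 2 + 2 * n + 2 * n / δ) * (δ * n + k) :=
    mul_le_mul_of_nonneg_right hv (by positivity)
  have h4 : (n - k) ^ 2 * k ≤ 4 / 27 * n ^ 3 := by
    -- 4/27 n^3 - (n-k)^2 k = (n/3 - k)^2 (4n/3 - k)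
    have : 4 / 27 * n ^ 3 - (n - k) ^ 2 * k = (n / 3 - k) ^ 2 * (4 * n / 3 - k) := by ring
    have h5 : 0 ≤ (n / 3 - k) ^ 2 * (4 * n / 3 - k) := mul_nonneg (sq_nonneg _) (by linarith)
    linarith
  have h5 : (n - k) ^ 2 * (δ * n) ≤ δ * n ^ 3 := by
    have : (n - k) ^ 2 ≤ n ^ 2 := by nlinarith
    calc (n - k) ^ 2 * (δ * n) ≤ n ^ 2 * (δ * n) := mul_le_mul_of_nonneg_right this (by positivity)
      _ = _ := by ring
  have h6 : (2 * n + 2 * n / δ) * (δ * n + k) ≤ 8 * n ^ 2 / δ := by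
    have a1 : 2 * n ≤ 2 * n / δ := by rw [le_div_iff₀ hδ]; nlinarith
    have a2 : δ * n + k ≤ 2 * n := by nlinarith
    calc (2 * n + 2 * n / δ) * (δ * n + k) ≤ (2 * n / δ + 2 * n / δ) * (2 * n) :=
          mul_le_mul (by linarith) a2 (by positivity) (by positivity)
      _ = _ := by ring
  nlinarith

lemma lap_sum (G : SimpleGraph V) {ι : Type} (s : Finset ι) (f : ι → V → ℝ) (x : V) :
    lap G (fun y => ∑ i ∈ s, f i y) x = ∑ i ∈ s, lap G (f i) x := by
  unfold lap
  rw [Finset.sum_comm]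
  refine Finset.sum_congr rfl fun y _ => ?_
  rw [← Finset.sum_sub_distrib, Finset.mul_sum]

lemma K_ge {G : SimpleGraph V} (hG : G.Connected) (hn : 2 ≤ Fintype.card V) (A : Finset V)
    (h : ℝ) (hA : ∀ u ∈ A, ∀ v ∈ A, u ≠ v → h ≤ H G u v) (U : Finset V) : U ⊆ A → U.Nonempty →
    ∀ x, (2 ≤ U.card ∨ (x ∈ A ∧ x ∉ U)) → h ≤ ∑ w ∈ U, (F G x U - F G x (U.erase w)) := by
  induction U using Finset.strongInduction with
  | H U ih =>
    intro hUA hU x hx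
    by_cases hc : 2 ≤ U.card
    · refine min_principle hG (U : Set V) hU
        (fun x => ∑ w ∈ U, (F G x U - F G x (U.erase w))) h ?_ ?_ x
      · intro y hy
        have hyU : y ∉ U := by simpa using hy
        rw [lap_sum]
        refine Finset.sum_nonneg fun w hw => ?_
        rw [lap_sub, lap_F hG hn y U hU hyU, lap_F hG hn y (U.erase w) _ _]
        · simp
        · rw [← Finset.card_pos, Finset.card_erase_of_mem hw]; omega
        · exact fun h => hyU (Finset.mem_of_mem_erase h)
      · intro y hy
        have hyU : y ∈ U := by simpa using hy
        have h1 := ih (U.erase y) (Finset.erase_ssubset hyU) ((Finset.erase_subset _ _).trans hUA)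
          (by rw [← Finset.card_pos, Finset.card_erase_of_mem hyU]; omega) y
          (Or.inr ⟨hUA hyU, Finset.notMem_erase y U⟩)
        rw [← Finset.add_sum_erase _ _ hyU, F_mem hG hn, sub_self, zero_add]
        refine h1.trans (le_of_eq (Finset.sum_congr rfl fun w _ => ?_))
        rw [F_mem hG hn, Finset.erase_right_comm, F_mem hG hn]
    · have hc1 : U.card = 1 := by have := hU.card_pos; omega
      obtain ⟨w, rfl⟩ := Finset.card_eq_one.mp hc1
      rcases hx with hx | hx
      · exact absurd hx hc
      · have h1 := hA w (hUA (by simp)) x hx.1 (by have := hx.2; simp at this; exact fun h => this h.symm)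
        simpa [F_empty, H] using h1

lemma matthews {G : SimpleGraph V} (hG : G.Connected) (hn : 2 ≤ Fintype.card V) (A : Finset V)
    (h : ℝ) (hA : ∀ u ∈ A, ∀ v ∈ A, u ≠ v → h ≤ H G u v) (k : ℕ) : ∀ U : Finset V, U.card = k →
    U ⊆ A → ∀ x ∈ A, x ∉ U → h * (harmonic k : ℝ) ≤ F G x U := by
  induction k with
  | zero => intro U _ _ x _ _; simpa using F_nonneg G x U
  | succ k ih =>
    intro U hk hUA x hx hxU
    have hU : U.Nonempty := by rw [← Finset.card_pos]; omega
    have h1 := K_ge hG hn A h hA U hUA hU x (Or.inr ⟨hx, hxU⟩)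
    have h2 : ∑ w ∈ U, h * (harmonic k : ℝ) ≤ ∑ w ∈ U, F G x (U.erase w) :=
      Finset.sum_le_sum fun w hw => ih (U.erase w) (by rw [Finset.card_erase_of_mem hw, hk]; rfl)
        ((Finset.erase_subset _ _).trans hUA) x hx (fun h => hxU (Finset.mem_of_mem_erase h))
    rw [Finset.sum_sub_distrib] at h1
    simp only [Finset.sum_const, nsmul_eq_mul, hk] at h1 h2
    rw [harmonic_succ]
    push_cast at *
    have hk' : (0:ℝ) < k + 1 := by positivity
    have h3 : ((k:ℝ) + 1) * (h * ((harmonic k : ℝ) + ((k:ℝ) + 1)⁻¹)) =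
        (k + 1) * (h * harmonic k) + h := by field_simp
    have h4 : ((k:ℝ) + 1) * (h * ((harmonic k : ℝ) + ((k:ℝ) + 1)⁻¹)) ≤ (k + 1) * F G x U := by
      rw [h3]; linarith
    exact le_of_mul_le_mul_left h4 hk'

lemma exists_indep (G : SimpleGraph V) (S : Finset V) (D : ℝ) (hD : ∀ v ∈ S, dg G v ≤ D) :
    ∃ S' ⊆ S, (∀ u ∈ S', ∀ v ∈ S', ¬ G.Adj u v) ∧ (S.card : ℝ) ≤ (D + 1) * S'.card := by
  let P := S.powerset.filter fun T => ∀ u ∈ T, ∀ v ∈ T, ¬ G.Adj u v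
  obtain ⟨T, hT, hmax⟩ := Finset.exists_max_image P Finset.card ⟨∅, by simp [P]⟩
  simp only [P, Finset.mem_filter, Finset.mem_powerset] at hT hmax
  refine ⟨T, hT.1, hT.2, ?_⟩
  have hcov : S ⊆ T.biUnion fun v => insert v (Finset.univ.filter fun y => G.Adj v y) := by
    intro x hx
    by_contra hc
    simp only [Finset.mem_biUnion, Finset.mem_insert, Finset.mem_filter, Finset.mem_univ, true_and,
      not_exists, not_and, not_or] at hc
    have hxT : x ∉ T := fun h => (hc x h).1 rfl
    have := hmax (insert x T) ⟨Finset.insert_subset hx hT.1, by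
      intro u hu v hv
      rcases Finset.mem_insert.mp hu with rfl | hu' <;> rcases Finset.mem_insert.mp hv with rfl | hv'
      · exact G.loopless.irrefl _
      · exact fun h => (hc v hv').2 h.symm
      · exact (hc u hu').2
      · exact hT.2 u hu' v hv'⟩
    rw [Finset.card_insert_of_notMem hxT] at this
    omega
  have h1 : (S.card : ℝ) ≤ ∑ v ∈ T, ((insert v (Finset.univ.filter fun y => G.Adj v y)).card : ℝ) := by
    exact_mod_cast (Finset.card_le_card hcov).trans Finset.card_biUnion_le
  refine h1.trans ?_
  have h2 : ∀ v ∈ T, ((insert v (Finset.univ.filter fun y => G.Adj v y)).card : ℝ) ≤ D + 1 := by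
    intro v hv
    have h3 : dg G v = ((Finset.univ.filter fun y => G.Adj v y).card : ℝ) := by
      unfold dg adj; rw [Finset.sum_boole]
    have h4 := hD v (hT.1 hv)
    have h5 : ((insert v (Finset.univ.filter fun y => G.Adj v y)).card : ℝ) ≤
        ((Finset.univ.filter fun y => G.Adj v y).card : ℝ) + 1 := by
      exact_mod_cast Finset.card_insert_le _ _
    linarith
  refine (Finset.sum_le_sum h2).trans ?_
  rw [Finset.sum_const, nsmul_eq_mul, mul_comm]

lemma exists_sep {G : SimpleGraph V} (hG : G.Connected) (hn : 2 ≤ Fintype.card V)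
    (δ : ℝ) (hδ : 0 < δ) (hδ1 : δ ≤ 1) (S : Finset V)
    (hS : ∀ v ∈ S, dg G v ≤ (1 + δ) * vol G / Fintype.card V) :
    ∃ S' ⊆ S, (S.card : ℝ) * δ / 2 ≤ S'.card ∧
      ∀ u ∈ S', ∀ v ∈ S', u ≠ v → 2 * ((Fintype.card V : ℝ) * (1 - 2 * δ)) ≤ Cm G u v := by
  have hn' : (2 : ℝ) ≤ Fintype.card V := by exact_mod_cast hn
  have hvol := vol_pos hG hn
  set n : ℝ := ((Fintype.card V : ℕ) : ℝ)
  set D : ℝ := (1 + δ) * vol G / n with hDdef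
  have hDpos : 0 < D := by positivity
  have hDn : D * n = (1 + δ) * vol G := div_mul_cancel₀ _ (by positivity)
  have key : ∀ e : ℝ, 0 < e → e ≤ D * (1 + δ) → n * (1 - 2 * δ) ≤ vol G / e := by
    intro e he heD
    rw [le_div_iff₀ he]
    by_cases hs : 1 - 2 * δ ≤ 0
    · have : n * (1 - 2 * δ) * e ≤ 0 :=
        mul_nonpos_of_nonpos_of_nonneg (mul_nonpos_of_nonneg_of_nonpos (by positivity) hs) he.le
      linarith
    · push Not at hs
      calc n * (1 - 2 * δ) * e ≤ n * (1 - 2 * δ) * (D * (1 + δ)) :=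
            mul_le_mul_of_nonneg_left heD (by positivity)
        _ = (D * n) * ((1 - 2 * δ) * (1 + δ)) := by ring
        _ = vol G * ((1 - 2 * δ) * (1 + δ) ^ 2) := by rw [hDn]; ring
        _ ≤ vol G * 1 := by
            apply mul_le_mul_of_nonneg_left _ hvol.le
            have : 0 < δ ^ 2 := by positivity
            have : 0 < δ ^ 3 := by positivity
            nlinarith
        _ = vol G := mul_one _
  by_cases hD : D ≤ 1 / δ
  · obtain ⟨T, hTS, hT1, hT2⟩ := exists_indep G S D hS
    refine ⟨T, hTS, ?_, ?_⟩
    · have h0 : (0:ℝ) ≤ T.card := by positivity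
      have h1 : D + 1 ≤ 2 / δ := by
        have : 1 ≤ 1 / δ := by rw [le_div_iff₀ hδ]; linarith
        have : 2 / δ = 1 / δ + 1 / δ := by ring
        linarith
      have h2 : (S.card : ℝ) ≤ 2 / δ * T.card := hT2.trans (mul_le_mul_of_nonneg_right h1 h0)
      calc (S.card : ℝ) * δ / 2 ≤ 2 / δ * T.card * δ / 2 := by gcongr
        _ = T.card := by field_simp
    · intro u hu v hv huv
      have h1 := le_Cm hG hn huv
      have h2 : adj G u v = 0 := by simp [adj, hT1 u hu v hv]
      have hu1 := one_le_dg hG hn u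
      have hv1 := one_le_dg hG hn v
      rw [h2, add_zero, add_zero] at h1
      have h3 := key (dg G u) (by linarith) (by nlinarith [hS u (hTS hu)])
      have h4 := key (dg G v) (by linarith) (by nlinarith [hS v (hTS hv)])
      linarith
  · push Not at hD
    refine ⟨S, subset_rfl, ?_, ?_⟩
    · have h0 : (0:ℝ) ≤ S.card := by positivity
      nlinarith
    · intro u hu v hv huv
      have h1 := le_Cm hG hn huv
      have hu1 := one_le_dg hG hn u
      have hv1 := one_le_dg hG hn v
      have ha := adj_nonneg G u v
      have ha' := adj_le_one G u v
      have hD' : 1 ≤ D * δ := by rw [div_lt_iff₀ hδ] at hD; linarith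
      have h3 := key (dg G u + adj G u v) (by linarith) (by nlinarith [hS u hu])
      have h4 := key (dg G v + adj G u v) (by linarith) (by nlinarith [hS v hv])
      linarith

lemma many_small (G : SimpleGraph V) (hvol : 0 < vol G) (hn : 0 < Fintype.card V)
    (δ : ℝ) (hδ : 0 < δ) (hδ1 : δ ≤ 1) :
    (Fintype.card V : ℝ) * δ / 2 ≤
      ((Finset.univ.filter fun v => dg G v ≤ (1 + δ) * vol G / Fintype.card V).card : ℝ) := by
  have hn' : (0 : ℝ) < Fintype.card V := by exact_mod_cast hn
  set S := Finset.univ.filter fun v => dg G v ≤ (1 + δ) * vol G / Fintype.card V with hS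
  have h1 : (Fintype.card V : ℝ) = S.card +
      (Finset.univ.filter fun v => ¬ dg G v ≤ (1 + δ) * vol G / Fintype.card V).card := by
    rw [← Finset.card_univ]
    exact_mod_cast (Finset.card_filter_add_card_filter_not _).symm
  set B := Finset.univ.filter fun v => ¬ dg G v ≤ (1 + δ) * vol G / Fintype.card V with hB
  have h2 : (B.card : ℝ) * ((1 + δ) * vol G / Fintype.card V) ≤ vol G := by
    rw [← nsmul_eq_mul]
    refine (Finset.card_nsmul_le_sum B (fun v => dg G v) _ ?_).trans ?_
    · intro v hv
      have := (Finset.mem_filter.mp hv).2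
      push Not at this; exact this.le
    · exact Finset.sum_le_sum_of_subset_of_nonneg (Finset.subset_univ _)
        fun v _ _ => Finset.sum_nonneg fun y _ => adj_nonneg G v y
  have h3 : (B.card : ℝ) * (1 + δ) ≤ Fintype.card V := by
    have h4 : (B.card : ℝ) * ((1 + δ) * vol G / Fintype.card V) =
      vol G * (B.card * (1 + δ) / Fintype.card V) := by ring
    rw [h4] at h2
    have h5 : (B.card : ℝ) * (1 + δ) / Fintype.card V ≤ 1 :=
      le_of_mul_le_mul_left (by linarith) hvol
    rw [div_le_one hn'] at h5
    exact h5
  set n : ℝ := ((Fintype.card V : ℕ) : ℝ)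
  have h6 : (B.card : ℝ) ≤ n * (1 - δ / 2) := by
    have : n ≤ n * (1 - δ / 2) * (1 + δ) := by
      have : n * (1 - δ / 2) * (1 + δ) - n = n * (δ * (1 - δ) / 2) := by ring
      have : 0 ≤ n * (δ * (1 - δ) / 2) :=
        mul_nonneg hn'.le (div_nonneg (mul_nonneg hδ.le (by linarith)) (by norm_num))
      linarith
    exact le_of_mul_le_mul_right (h3.trans this) (by linarith)
  linarith

lemma lower {G : SimpleGraph V} (hG : G.Connected) (hn : 2 ≤ Fintype.card V)
    (δ : ℝ) (hδ : 0 < δ) (hδ1 : δ ≤ 1 / 4) (L : ℝ) (hL : 1 ≤ L) :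
    (∃ v, (Fintype.card V : ℝ) * L ≤ coverTimeFrom G v) ∨
    ∃ v, (Fintype.card V : ℝ) * (1 - 3 * δ) * Real.log (δ ^ 3 / 8 * (Fintype.card V : ℝ) / L) ≤
      coverTimeFrom G v := by
  have hn' : (2 : ℝ) ≤ Fintype.card V := by exact_mod_cast hn
  have hvol := vol_pos hG hn
  have hFle : ∀ x U, F G x U ≤ coverTimeFrom G x := fun x U => by
    rw [coverTimeFrom_eq]; exact F_mono hG hn x (Finset.subset_univ U)
  by_cases hbig : ∃ u v, (Fintype.card V : ℝ) * L ≤ H G u v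
  · obtain ⟨u, v, h⟩ := hbig
    exact Or.inl ⟨v, h.trans (hFle v {u})⟩
  right
  push Not at hbig
  have hms := many_small G hvol (by omega) δ hδ (by linarith)
  set S := Finset.univ.filter fun v => dg G v ≤ (1 + δ) * vol G / Fintype.card V with hS
  set n : ℝ := ((Fintype.card V : ℕ) : ℝ)
  let φ : V → ℝ := fun u => (∑ x, dg G x * H G u x) / vol G
  have hφ0 : ∀ u, 0 ≤ φ u := fun u => div_nonneg (Finset.sum_nonneg fun x _ =>
    mul_nonneg (by linarith [one_le_dg hG hn x]) (H_nonneg _ _ _)) hvol.le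
  have hφ1 : ∀ u, φ u ≤ n * L := by
    intro u
    rw [div_le_iff₀ hvol]
    calc ∑ x, dg G x * H G u x ≤ ∑ x, dg G x * (n * L) := Finset.sum_le_sum fun x _ =>
          mul_le_mul_of_nonneg_left (hbig u x).le (by linarith [one_le_dg hG hn x])
      _ = n * L * vol G := by rw [← Finset.sum_mul]; exact mul_comm _ _
  have hφd : ∀ u v, H G u v - H G v u = φ u - φ v := by
    intro u v
    have := diff_H hG hn u v
    simp only [φ]
    rw [← sub_div, ← this]
    field_simp
  have hδn : 0 < δ * n := by positivity
  let bk : V → ℕ := fun u => ⌊φ u / (δ * n)⌋₊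
  let t := Finset.range (⌊L / δ⌋₊ + 1)
  have hmaps : ∀ a ∈ S, bk a ∈ t := by
    intro a _
    simp only [t, bk, Finset.mem_range, Nat.lt_succ_iff]
    apply Nat.floor_le_floor
    rw [div_le_div_iff₀ hδn hδ]
    nlinarith [hφ1 a]
  have htc : (t.card : ℝ) ≤ 2 * L / δ := by
    simp only [t, Finset.card_range]
    push_cast
    have h1 := Nat.floor_le (a := L / δ) (by positivity)
    have h2 : 1 ≤ L / δ := by rw [le_div_iff₀ hδ]; linarith
    have : 2 * L / δ = L / δ + L / δ := by ring
    linarith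
  have htpos : (0 : ℝ) < t.card := by simp only [t, Finset.card_range]; positivity
  obtain ⟨y, _, hy⟩ := Finset.exists_le_card_fiber_of_nsmul_le_card_of_maps_to
    (s := S) (t := t) (f := bk) (b := (S.card : ℝ) / t.card) hmaps ⟨0, by simp [t]⟩
    (by rw [nsmul_eq_mul]; exact (mul_div_cancel₀ _ htpos.ne').le)
  set S1 := S.filter fun x => bk x = y with hS1
  obtain ⟨S2, hS21, hS2c, hS2⟩ := exists_sep hG hn δ hδ (by linarith) S1
    (fun v hv => (Finset.mem_filter.mp (Finset.mem_filter.mp hv).1).2)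
  have hcard : δ ^ 3 / 8 * n / L ≤ S2.card := by
    have h1 : n * δ / 2 / (2 * L / δ) ≤ (S.card : ℝ) / t.card :=
      div_le_div₀ (by positivity) hms htpos htc
    calc δ ^ 3 / 8 * n / L = (n * δ / 2 / (2 * L / δ)) * δ / 2 := by field_simp; norm_num
      _ ≤ S1.card * δ / 2 := by
        have := h1.trans hy
        gcongr
      _ ≤ S2.card := hS2c
  have hpos : 0 < δ ^ 3 / 8 * n / L := by positivity
  have hS2pos : 0 < S2.card := by
    have : (0:ℝ) < S2.card := lt_of_lt_of_le hpos hcard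
    exact_mod_cast this
  have hHit : ∀ u ∈ S2, ∀ v ∈ S2, u ≠ v → n * (1 - 3 * δ) ≤ H G u v := by
    intro u hu v hv huv
    have h1 := hS2 u hu v hv huv
    have h2 := hφd u v
    have hbu : bk u = y := (Finset.mem_filter.mp (hS21 hu)).2
    have hbv : bk v = y := (Finset.mem_filter.mp (hS21 hv)).2
    have a1 := Nat.floor_le (a := φ u / (δ * n)) (div_nonneg (hφ0 u) hδn.le)
    have a2 := Nat.lt_floor_add_one (φ v / (δ * n))
    have e1 : ⌊φ u / (δ * n)⌋₊ = y := hbu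
    have e2 : ⌊φ v / (δ * n)⌋₊ = y := hbv
    rw [e1, le_div_iff₀ hδn] at a1
    rw [e2, div_lt_iff₀ hδn] at a2
    unfold Cm at h1
    nlinarith
  obtain ⟨x, hx⟩ := Finset.card_pos.mp hS2pos
  refine ⟨x, ?_⟩
  have hm := matthews hG hn S2 _ hHit (S2.card - 1) (S2.erase x)
    (Finset.card_erase_of_mem hx) (Finset.erase_subset _ _) x hx (Finset.notMem_erase _ _)
  refine le_trans ?_ (hm.trans (hFle _ _))
  apply mul_le_mul_of_nonneg_left _ (mul_nonneg (by linarith) (by linarith))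
  refine le_trans ?_ (log_add_one_le_harmonic (S2.card - 1))
  rw [Nat.sub_add_cancel hS2pos]
  exact Real.log_le_log hpos hcard

lemma eventually_log (δ : ℝ) (hδ : 0 < δ) : ∃ N : ℕ, ∀ n : ℕ, N ≤ n →
    1 ≤ Real.log n ∧
    (1 - δ) * Real.log n ≤ Real.log (δ ^ 3 / 8 * (n : ℝ) / Real.log n) := by
  have ht : Filter.Tendsto (fun n : ℕ => Real.log (n : ℝ)) Filter.atTop Filter.atTop :=
    Real.tendsto_log_atTop.comp tendsto_natCast_atTop_atTop
  have h1 := ht.eventually (Real.isLittleO_log_id_atTop.bound (show (0:ℝ) < δ / 2 by linarith))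
  have h2 := ht.eventually (Filter.eventually_ge_atTop (max 1 (- Real.log (δ ^ 3 / 8) / (δ / 2))))
  obtain ⟨N, hN⟩ := Filter.eventually_atTop.mp ((h1.and h2).and (Filter.eventually_ge_atTop 1))
  refine ⟨N, fun n hn => ?_⟩
  obtain ⟨⟨a1, a2⟩, a3⟩ := hN n hn
  have hL1 : 1 ≤ Real.log n := (le_max_left _ _).trans a2
  have a4 := (le_max_right _ _).trans a2
  refine ⟨hL1, ?_⟩
  have hn0 : (n : ℝ) ≠ 0 := by positivity
  rw [Real.log_div (by positivity) (by linarith), Real.log_mul (by positivity) hn0]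
  simp only [id, Real.norm_eq_abs] at a1
  rw [abs_of_nonneg (show 0 ≤ Real.log n by linarith)] at a1
  have a5 := (le_abs_self _).trans a1
  rw [div_le_iff₀ (by linarith)] at a4
  nlinarith

end CoverAux

open CoverTimePaper in
/-- Feige's bounds.  For every `ε > 0` there exists `N` such that every
finite connected simple graph `G` with `n ≥ N` vertices has cover time at least
`(1 - ε) n log n` and at most `(1 + ε) (4/27) n³`. -/
theorem cover_time_general_bounds :
    ∀ ε : ℝ, 0 < ε → ∃ N : ℕ,
      ∀ (V : Type) [Fintype V] (G : SimpleGraph V), G.Connected →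
        N ≤ Fintype.card V →
        (1 - ε) * (Fintype.card V : ℝ) * Real.log (Fintype.card V) ≤ coverTime G ∧
        coverTime G ≤ (1 + ε) * (4 / 27) * (Fintype.card V : ℝ) ^ 3 := by
  intro ε hε
  obtain ⟨δ, hδ, hδ1, hδε⟩ : ∃ δ : ℝ, 0 < δ ∧ δ ≤ 1 / 4 ∧ 27 * δ ≤ 2 * ε :=
    ⟨min (1 / 4) (2 * ε / 27), by positivity, min_le_left _ _, by
      have := min_le_right (1 / 4) (2 * ε / 27); linarith⟩
  obtain ⟨N1, hN1⟩ := CoverAux.eventually_log δ hδ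
  obtain ⟨N2, hN2⟩ := exists_nat_ge (27 * 8 / (2 * δ * ε))
  refine ⟨max 2 (max N1 N2), ?_⟩
  intro V _ G hG hN
  have hn : 2 ≤ Fintype.card V := (le_max_left _ _).trans hN
  have hn1 : N1 ≤ Fintype.card V := (le_max_left _ _).trans ((le_max_right _ _).trans hN)
  have hn2 : N2 ≤ Fintype.card V := (le_max_right _ _).trans ((le_max_right _ _).trans hN)
  obtain ⟨hL1, hL2⟩ := hN1 _ hn1
  have hn' : (2 : ℝ) ≤ Fintype.card V := by exact_mod_cast hn
  have hN2' : 27 * 8 / (2 * δ * ε) ≤ (Fintype.card V : ℝ) :=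
    hN2.trans (by exact_mod_cast hn2)
  have hle : ∀ v, coverTimeFrom G v ≤ coverTime G := fun v =>
    le_ciSup (Set.finite_range _).bddAbove v
  constructor
  · set n : ℝ := ((Fintype.card V : ℕ) : ℝ)
    have hnL : 0 ≤ n * Real.log n := mul_nonneg (by linarith) (by linarith)
    rcases CoverAux.lower hG hn δ hδ hδ1 (Real.log n) hL1 with ⟨v, hv⟩ | ⟨v, hv⟩
    · refine le_trans ?_ (hv.trans (hle v))
      nlinarith
    · refine le_trans ?_ (hv.trans (hle v))
      have h1 : 0 ≤ n * (1 - 3 * δ) := mul_nonneg (by linarith) (by linarith)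
      have h2 := mul_le_mul_of_nonneg_left hL2 h1
      refine le_trans ?_ h2
      have h3 : n * (1 - 3 * δ) * ((1 - δ) * Real.log n) =
        (1 - 4 * δ + 3 * δ ^ 2) * (n * Real.log n) := by ring
      rw [h3, mul_assoc]
      apply mul_le_mul_of_nonneg_right _ hnL
      nlinarith [sq_nonneg δ]
  · have := hG.nonempty
    apply ciSup_le
    intro v
    refine (CoverAux.upper hG hn δ hδ (by linarith) v).trans ?_
    set n : ℝ := ((Fintype.card V : ℕ) : ℝ)
    have h1 : δ * n ^ 3 ≤ 2 / 27 * ε * n ^ 3 :=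
      mul_le_mul_of_nonneg_right (by linarith) (by positivity)
    have h2 : 8 * n ^ 2 / δ ≤ 2 / 27 * ε * n ^ 3 := by
      rw [div_le_iff₀ (by positivity)] at hN2'
      rw [div_le_iff₀ hδ]
      have : 8 ≤ 2 / 27 * ε * δ * n := by nlinarith
      calc 8 * n ^ 2 ≤ 2 / 27 * ε * δ * n * n ^ 2 :=
            mul_le_mul_of_nonneg_right this (by positivity)
        _ = _ := by ring
    linarith
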